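/- Let H0 be a hierarchy on [n] and T0 its induced triplet set. Then H0 maximizes the triplet revenue H ↦ Trev(H, T0) over all hierarchies on [n]; moreover, the maximum is unique up to isomorphism: for every hierarchy H1 on [n] whose induced triplet set differs from T0, Trev(H0, T0) > Trev(H1, T0). -/

import Mathlib

open Finset MeasureTheory

namespace CompHC

/-- A rooted binary tree with leaves labelled by elements of `Fin n`. -/
inductive HTree (n : ℕ) : Type
  | leaf (i : Fin n) : HTree n
  | node (l r : HTree n) : HTree n

namespace HTree

/-- The list of leaf labels of a tree. -/
def leaves {n : ℕ} : HTree n → List (Fin n)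
  | .leaf i => [i]
  | .node l r => l.leaves ++ r.leaves

/-- The number of leaves of a tree. -/
def size {n : ℕ} (t : HTree n) : ℕ := t.leaves.length

/-- `|H(i ∨ j)|`: the number of leaves of the smallest subtree containing both `i` and `j`. -/
def lcaSize {n : ℕ} : HTree n → Fin n → Fin n → ℕ
  | .leaf _, _, _ => 1
  | .node l r, i, j =>
      if i ∈ l.leaves ∧ j ∈ l.leaves then l.lcaSize i j
      else if i ∈ r.leaves ∧ j ∈ r.leaves then r.lcaSize i j
      else l.size + r.size

/-- Sum of `f |N1| |N2|` over the internal nodes `N` of the tree, `N1, N2` its children. -/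
def internalSum {n : ℕ} (f : ℕ → ℕ → ℕ) : HTree n → ℕ
  | .leaf _ => 0
  | .node l r => f l.size r.size + l.internalSum f + r.internalSum f

end HTree

/-- A hierarchy on `[n]`: every object appears exactly once as a leaf. -/
def IsHierarchy {n : ℕ} (t : HTree n) : Prop :=
  t.leaves.Nodup ∧ ∀ i : Fin n, i ∈ t.leaves

abbrev Triplet (n : ℕ) := Fin n × Fin n × Fin n
abbrev Quadruplet (n : ℕ) := Fin n × Fin n × Fin n × Fin n

/-- The entries of a triplet are pairwise distinct. -/
def distinctTriplet {n : ℕ} (t : Triplet n) : Prop :=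
  t.1 ≠ t.2.1 ∧ t.1 ≠ t.2.2 ∧ t.2.1 ≠ t.2.2

/-- A quadruplet `(i,j,k,l)` satisfies `i<j`, `k<l`, `(i,j) ≠ (k,l)`. -/
def validQuadruplet {n : ℕ} (q : Quadruplet n) : Prop :=
  q.1 < q.2.1 ∧ q.2.2.1 < q.2.2.2 ∧ (q.1, q.2.1) ≠ (q.2.2.1, q.2.2.2)

/-- Triplet revenue `Trev(H,T) = Σ_{(i,j,k)∈T} (|H(i∨k)| − |H(i∨j)|)`. -/
def Trev {n : ℕ} (H : HTree n) (T : Finset (Triplet n)) : ℤ :=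
  ∑ t ∈ T, ((H.lcaSize t.1 t.2.2 : ℤ) - (H.lcaSize t.1 t.2.1 : ℤ))

/-- Quadruplet revenue `Qrev(H,Q) = Σ_{(i,j,k,l)∈Q} (|H(k∨l)| − |H(i∨j)|)`. -/
def Qrev {n : ℕ} (H : HTree n) (Q : Finset (Quadruplet n)) : ℤ :=
  ∑ q ∈ Q, ((H.lcaSize q.2.2.1 q.2.2.2 : ℤ) - (H.lcaSize q.1 q.2.1 : ℤ))

/-- The set of pairs `(i,j)` with `i < j`. -/
def pairs (n : ℕ) : Finset (Fin n × Fin n) :=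
  Finset.univ.filter fun p => p.1 < p.2

/-- Dasgupta's cost `Dcost(H,s) = Σ_{i<j} s_{ij}·|H(i∨j)|`. -/
noncomputable def Dcost {n : ℕ} (H : HTree n) (s : Fin n → Fin n → ℝ) : ℝ :=
  ∑ p ∈ pairs n, s p.1 p.2 * (H.lcaSize p.1 p.2 : ℝ)

/-- The AddS3 similarity computed from a triplet set. -/
def sAddS3 {n : ℕ} (T : Finset (Triplet n)) (i j : Fin n) : ℤ :=
  ∑ k ∈ Finset.univ.filter (fun k : Fin n => k ≠ i ∧ k ≠ j),
    (((if (i, j, k) ∈ T then 1 else 0) - (if (i, k, j) ∈ T then 1 else 0)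
      + (if (j, i, k) ∈ T then 1 else 0) - (if (j, k, i) ∈ T then 1 else 0) : ℤ))

/-- The AddS4 similarity computed from a quadruplet set. -/
def sAddS4 {n : ℕ} (Q : Finset (Quadruplet n)) (i j : Fin n) : ℤ :=
  ∑ p ∈ (pairs n).filter (fun p => p ≠ (i, j)),
    (((if (i, j, p.1, p.2) ∈ Q then 1 else 0)
      - (if (p.1, p.2, i, j) ∈ Q then 1 else 0) : ℤ))

/-- The triplet set induced by a hierarchy `H0`:
`T0 = {(i,j,k) : i,j,k pairwise distinct, |H0(i∨j)| < min(|H0(i∨k)|, |H0(j∨k)|)}`. -/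
def inducedTriplets {n : ℕ} (H : HTree n) : Finset (Triplet n) :=
  Finset.univ.filter fun t : Triplet n =>
    t.1 ≠ t.2.1 ∧ t.1 ≠ t.2.2 ∧ t.2.1 ≠ t.2.2 ∧
    H.lcaSize t.1 t.2.1 < min (H.lcaSize t.1 t.2.2) (H.lcaSize t.2.1 t.2.2)


namespace HTree

variable {n : ℕ}

/-- The set of leaf labels of a tree. -/
def support (t : HTree n) : Finset (Fin n) := t.leaves.toFinset

lemma mem_support {t : HTree n} {i : Fin n} : i ∈ t.support ↔ i ∈ t.leaves :=
  List.mem_toFinset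

lemma support_leaf (a : Fin n) : (leaf a).support = {a} := rfl

lemma support_node (l r : HTree n) : (node l r).support = l.support ∪ r.support :=
  List.toFinset_append

lemma size_node (l r : HTree n) : (node l r).size = l.size + r.size :=
  List.length_append

lemma size_pos (t : HTree n) : 0 < t.size := by
  induction t with
  | leaf a => exact Nat.one_pos
  | node l r ihl _ => rw [size_node]; lia

lemma card_support {t : HTree n} (ht : t.leaves.Nodup) : #t.support = t.size :=
  List.toFinset_card_of_nodup ht

lemma nodup_node {l r : HTree n} :
    (node l r).leaves.Nodup ↔
      l.leaves.Nodup ∧ r.leaves.Nodup ∧ Disjoint l.support r.support := by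
  simp only [leaves, List.nodup_append', support, List.disjoint_toFinset_iff_disjoint]

lemma lcaSize_comm (t : HTree n) (i j : Fin n) : t.lcaSize i j = t.lcaSize j i := by
  induction t with
  | leaf a => rfl
  | node l r ihl ihr =>
    simp only [lcaSize, ihl, ihr, and_comm]

lemma lcaSize_le_size (t : HTree n) (i j : Fin n) : t.lcaSize i j ≤ t.size := by
  induction t with
  | leaf a => exact le_rfl
  | node l r ihl ihr =>
    rw [size_node, lcaSize]
    split_ifs <;> lia

lemma lcaSize_self {t : HTree n} {i : Fin n} (hi : i ∈ t.support) : t.lcaSize i i = 1 := by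
  induction t with
  | leaf a => rfl
  | node l r ihl ihr =>
    rw [support_node, mem_union] at hi
    by_cases h : i ∈ l.support
    · simp [lcaSize, mem_support.1 h, ihl h]
    · have hr := hi.resolve_left h
      rw [mem_support] at h
      simp [lcaSize, h, mem_support.1 hr, ihr hr]

section Node

variable {l r : HTree n} {i j : Fin n}

lemma lcaSize_node_left (hi : i ∈ l.support) (hj : j ∈ l.support) :
    (node l r).lcaSize i j = l.lcaSize i j :=
  if_pos ⟨mem_support.1 hi, mem_support.1 hj⟩

lemma lcaSize_node_right (h : Disjoint l.support r.support)
    (hi : i ∈ r.support) (hj : j ∈ r.support) :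
    (node l r).lcaSize i j = r.lcaSize i j := by
  have hl : i ∉ l.leaves := fun hl => disjoint_left.1 h (mem_support.2 hl) hi
  simp [lcaSize, hl, mem_support.1 hi, mem_support.1 hj]

lemma lcaSize_node_cross (h : Disjoint l.support r.support)
    (hi : i ∈ l.support) (hj : j ∈ r.support) :
    (node l r).lcaSize i j = l.size + r.size := by
  have hjl : j ∉ l.leaves := fun hl => disjoint_left.1 h (mem_support.2 hl) hj
  have hir : i ∉ r.leaves := fun hr => disjoint_left.1 h hi (mem_support.2 hr)
  simp [lcaSize, hjl, hir]

lemma lcaSize_node_cross' (h : Disjoint l.support r.support)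
    (hi : i ∈ r.support) (hj : j ∈ l.support) :
    (node l r).lcaSize i j = l.size + r.size := by
  rw [lcaSize_comm, lcaSize_node_cross h hj hi]

end Node

/-- The tree `t` joins `i` and `j` strictly below the point where it joins them with `k`. -/
abbrev Separates (t : HTree n) (i j k : Fin n) : Prop :=
  i ≠ j ∧ i ≠ k ∧ j ≠ k ∧ t.lcaSize i j < min (t.lcaSize i k) (t.lcaSize j k)

lemma Separates.swap {t : HTree n} {i j k : Fin n} (h : t.Separates i j k) :
    t.Separates j i k := by
  obtain ⟨h1, h2, h3, h4⟩ := h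
  refine ⟨h1.symm, h3, h2, ?_⟩
  rwa [lcaSize_comm, min_comm]

section NodeSeparates

variable {l r : HTree n} {i j k : Fin n}

lemma separates_node_left (hi : i ∈ l.support) (hj : j ∈ l.support) (hk : k ∈ l.support) :
    (node l r).Separates i j k ↔ l.Separates i j k := by
  simp only [Separates, lcaSize_node_left, hi, hj, hk]

lemma separates_node_right (h : Disjoint l.support r.support)
    (hi : i ∈ r.support) (hj : j ∈ r.support) (hk : k ∈ r.support) :
    (node l r).Separates i j k ↔ r.Separates i j k := by
  simp only [Separates, lcaSize_node_right h, hi, hj, hk]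

lemma separates_node_left_right (h : Disjoint l.support r.support)
    (hi : i ∈ l.support) (hj : j ∈ l.support) (hk : k ∈ r.support) :
    (node l r).Separates i j k ↔ i ≠ j := by
  have hik := disjoint_iff_ne.1 h i hi k hk
  have hjk := disjoint_iff_ne.1 h j hj k hk
  have h1 := l.lcaSize_le_size i j
  have h2 := r.size_pos
  simp only [Separates, lcaSize_node_left hi hj, lcaSize_node_cross h hi hk,
    lcaSize_node_cross h hj hk, min_self]
  exact ⟨fun h => h.1, fun h => ⟨h, hik, hjk, by lia⟩⟩

lemma separates_node_right_left (h : Disjoint l.support r.support)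
    (hi : i ∈ r.support) (hj : j ∈ r.support) (hk : k ∈ l.support) :
    (node l r).Separates i j k ↔ i ≠ j := by
  have hik := (disjoint_iff_ne.1 h k hk i hi).symm
  have hjk := (disjoint_iff_ne.1 h k hk j hj).symm
  have h1 := r.lcaSize_le_size i j
  have h2 := l.size_pos
  simp only [Separates, lcaSize_node_right h hi hj, lcaSize_node_cross' h hi hk,
    lcaSize_node_cross' h hj hk, min_self]
  exact ⟨fun h => h.1, fun h => ⟨h, hik, hjk, by lia⟩⟩

lemma not_separates_of_lcaSize_eq_size {t : HTree n} (h : t.lcaSize i j = t.size) :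
    ¬ t.Separates i j k := by
  rintro ⟨-, -, -, h4⟩
  have := t.lcaSize_le_size i k
  lia

lemma not_separates_node_cross (h : Disjoint l.support r.support)
    (hi : i ∈ l.support) (hj : j ∈ r.support) : ¬ (node l r).Separates i j k :=
  not_separates_of_lcaSize_eq_size (by rw [lcaSize_node_cross h hi hj, size_node])

lemma not_separates_node_cross' (h : Disjoint l.support r.support)
    (hi : i ∈ r.support) (hj : j ∈ l.support) : ¬ (node l r).Separates i j k :=
  fun hs => not_separates_node_cross h hj hi hs.swap

end NodeSeparates

/-- Since the tree is binary, every three leaves are resolved. -/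
lemma separates_trichotomy {t : HTree n} (ht : t.leaves.Nodup) {i j k : Fin n}
    (hi : i ∈ t.support) (hj : j ∈ t.support) (hk : k ∈ t.support)
    (hij : i ≠ j) (hik : i ≠ k) (hjk : j ≠ k) :
    t.Separates i j k ∨ t.Separates i k j ∨ t.Separates j k i := by
  induction t with
  | leaf a =>
    rw [support_leaf, mem_singleton] at hi hj
    exact absurd (hi.trans hj.symm) hij
  | node l r ihl ihr =>
    obtain ⟨hl, hr, hd⟩ := nodup_node.1 ht
    rw [support_node, mem_union] at hi hj hk
    rcases hi with hi | hi <;> rcases hj with hj | hj <;> rcases hk with hk | hk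
    · simpa only [separates_node_left, hi, hj, hk] using ihl hl hi hj hk
    · exact .inl ((separates_node_left_right hd hi hj hk).2 hij)
    · exact .inr (.inl ((separates_node_left_right hd hi hk hj).2 hik))
    · exact .inr (.inr ((separates_node_right_left hd hj hk hi).2 hjk))
    · exact .inr (.inr ((separates_node_left_right hd hj hk hi).2 hjk))
    · exact .inr (.inl ((separates_node_right_left hd hi hk hj).2 hik))
    · exact .inl ((separates_node_right_left hd hi hj hk).2 hij)
    · simpa only [separates_node_right hd, hi, hj, hk] using ihr hr hi hj hk

end HTree

section PairSum

variable {n : ℕ}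

/-- The sum of `g` over all ordered pairs, diagonal included, of elements of `A`. -/
def pairSum (g : Fin n → Fin n → ℤ) (A : Finset (Fin n)) : ℤ :=
  ∑ i ∈ A, ∑ j ∈ A, g i j

lemma pairSum_union {g : Fin n → Fin n → ℤ} (hg : ∀ i j, g i j = g j i)
    {A B : Finset (Fin n)} (h : Disjoint A B) :
    pairSum g (A ∪ B) = pairSum g A + pairSum g B + 2 * ∑ i ∈ A, ∑ j ∈ B, g i j := by
  have hBA : ∑ i ∈ B, ∑ j ∈ A, g i j = ∑ i ∈ A, ∑ j ∈ B, g i j := by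
    rw [sum_comm]
    exact sum_congr rfl fun i _ => sum_congr rfl fun j _ => hg _ _
  simp only [pairSum, sum_union h, sum_add_distrib, hBA]
  ring

lemma pairSum_congr {g g' : Fin n → Fin n → ℤ} {A : Finset (Fin n)}
    (h : ∀ i ∈ A, ∀ j ∈ A, g i j = g' i j) : pairSum g A = pairSum g' A :=
  sum_congr rfl fun i hi => sum_congr rfl fun j hj => h i hi j hj

lemma sum_off_diag_sub {g : Fin n → Fin n → ℤ} (A B : Finset (Fin n))
    (hg : ∀ i ∈ A, g i i = 1) :
    ∑ i ∈ A, ∑ j ∈ A, ∑ k ∈ B, (if i ≠ j then g i k - g i j else 0) =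
      ((#A : ℤ) - 1) * (∑ i ∈ A, ∑ k ∈ B, g i k) - #B * pairSum g A + #A * #B := by
  have hrow : ∀ i ∈ A, ∑ j ∈ A, ∑ k ∈ B, (if i ≠ j then g i k - g i j else 0) =
      ((#A : ℤ) - 1) * (∑ k ∈ B, g i k) - #B * (∑ j ∈ A, g i j) + #B := by
    intro i hi
    have hterm : ∀ j ∈ A, ∑ k ∈ B, (if i ≠ j then g i k - g i j else 0) =
        (∑ k ∈ B, g i k) - #B * g i j - if i = j then (∑ k ∈ B, g i k) - #B else 0 := by
      intro j _
      by_cases hij : i = j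
      · subst hij
        simp [hg i hi]
      · simp [hij, sum_sub_distrib]
    rw [sum_congr rfl hterm, sum_sub_distrib, sum_sub_distrib, sum_const, sum_ite_eq, if_pos hi,
      ← mul_sum, nsmul_eq_mul]
    ring
  rw [sum_congr rfl hrow, sum_add_distrib, sum_sub_distrib, ← mul_sum, ← mul_sum, sum_const,
    nsmul_eq_mul, pairSum]

end PairSum

namespace HTree

variable {n : ℕ}

/-- The function `(i, j) ↦ |H(i ∨ j)|` with integer values. -/
def lcaSizeInt (H : HTree n) (i j : Fin n) : ℤ := H.lcaSize i j

lemma lcaSizeInt_comm (H : HTree n) (i j : Fin n) : H.lcaSizeInt i j = H.lcaSizeInt j i := by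
  rw [lcaSizeInt, lcaSize_comm, lcaSizeInt]

lemma lcaSizeInt_self {H : HTree n} {i : Fin n} (hi : i ∈ H.support) :
    H.lcaSizeInt i i = 1 := by
  rw [lcaSizeInt, lcaSize_self hi, Nat.cast_one]

lemma pairSum_node {l r : HTree n} (hd : Disjoint l.support r.support) {A B : Finset (Fin n)}
    (hA : A ⊆ l.support) (hB : B ⊆ r.support) :
    pairSum (node l r).lcaSizeInt (A ∪ B) =
      pairSum l.lcaSizeInt A + pairSum r.lcaSizeInt B + 2 * (#A * #B * (node l r).size) := by
  have hcross : ∑ i ∈ A, ∑ j ∈ B, (node l r).lcaSizeInt i j = #A * #B * (node l r).size := by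
    rw [sum_congr rfl fun i hi => sum_congr rfl fun j hj =>
      (by rw [lcaSizeInt, lcaSize_node_cross hd (hA hi) (hB hj), size_node] :
        (node l r).lcaSizeInt i j = ((node l r).size : ℤ))]
    simp only [sum_const, nsmul_eq_mul]
    ring
  rw [pairSum_union (lcaSizeInt_comm _) (disjoint_of_subset_left hA (disjoint_of_subset_right hB hd)),
    hcross]
  congr 2
  · exact pairSum_congr fun i hi j hj => by
      rw [lcaSizeInt, lcaSize_node_left (hA hi) (hA hj), lcaSizeInt]
  · exact pairSum_congr fun i hi j hj => by
      rw [lcaSizeInt, lcaSize_node_right hd (hB hi) (hB hj), lcaSizeInt]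

lemma pairSum_leaf_eq {a : Fin n} {C : Finset (Fin n)} (hC : C ⊆ (leaf a).support) :
    3 * pairSum (leaf a).lcaSizeInt C = 2 * (#C : ℤ) ^ 3 + #C := by
  rcases subset_singleton_iff.1 hC with rfl | rfl <;>
    simp [pairSum, lcaSizeInt, lcaSize]

lemma exists_split {l r : HTree n} (hd : Disjoint l.support r.support) {C : Finset (Fin n)}
    (hC : C ⊆ (node l r).support) :
    ∃ A B, A ⊆ l.support ∧ B ⊆ r.support ∧ Disjoint A B ∧ C = A ∪ B := by
  refine ⟨C ∩ l.support, C ∩ r.support, inter_subset_right, inter_subset_right,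
    disjoint_of_subset_left inter_subset_right (disjoint_of_subset_right inter_subset_right hd), ?_⟩
  rw [← inter_union_distrib_left, ← support_node, inter_eq_left.2 hC]

/-- Pairs inside `C` cost at least as much in `H` as in any tree with leaf set `C`. -/
lemma le_pairSum {H : HTree n} (hH : H.leaves.Nodup) {C : Finset (Fin n)}
    (hC : C ⊆ H.support) :
    2 * (#C : ℤ) ^ 3 + #C ≤ 3 * pairSum H.lcaSizeInt C := by
  induction H generalizing C with
  | leaf a => exact (pairSum_leaf_eq hC).ge
  | node l r ihl ihr =>
    obtain ⟨hl, hr, hd⟩ := nodup_node.1 hH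
    obtain ⟨A, B, hA, hB, hAB, rfl⟩ := exists_split hd hC
    have hcard := card_le_card hC
    rw [card_support hH, card_union_of_disjoint hAB] at hcard
    rw [pairSum_node hd hA hB, card_union_of_disjoint hAB]
    have hm : (#A * #B : ℤ) * (#A + #B) ≤ #A * #B * (node l r).size :=
      mul_le_mul_of_nonneg_left (by exact_mod_cast hcard) (by positivity)
    push_cast
    linarith [ihl hl hA, ihr hr hB]

lemma pairSum_support {H : HTree n} (hH : H.leaves.Nodup) :
    3 * pairSum H.lcaSizeInt H.support = 2 * (H.size : ℤ) ^ 3 + H.size := by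
  induction H with
  | leaf a => exact pairSum_leaf_eq Subset.rfl
  | node l r ihl ihr =>
    obtain ⟨hl, hr, hd⟩ := nodup_node.1 hH
    rw [support_node, pairSum_node hd Subset.rfl Subset.rfl, card_support hl, card_support hr,
      size_node]
    push_cast
    linarith [ihl hl, ihr hr]

/-- If `C` attains the bound of `le_pairSum`, then `H` joins the elements of `C` before
joining any of them with an element outside `C`. -/
lemma lcaSize_lt_of_pairSum_eq {H : HTree n} (hH : H.leaves.Nodup) {C : Finset (Fin n)}
    (hC : C ⊆ H.support) (heq : 3 * pairSum H.lcaSizeInt C = 2 * (#C : ℤ) ^ 3 + #C)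
    {i j k : Fin n} (hi : i ∈ C) (hj : j ∈ C) (hk : k ∈ H.support) (hkC : k ∉ C) :
    H.lcaSize i j < H.lcaSize i k := by
  induction H generalizing C with
  | leaf a =>
    rcases subset_singleton_iff.1 hC with rfl | rfl
    · simp at hi
    · exact absurd hk hkC
  | node l r ihl ihr =>
    obtain ⟨hl, hr, hd⟩ := nodup_node.1 hH
    have hcard : #C < (node l r).size := by
      rw [← card_support hH]
      exact card_lt_card (ssubset_iff_of_subset hC |>.2 ⟨k, hk, hkC⟩)
    obtain ⟨A, B, hA, hB, hAB, rfl⟩ := exists_split hd hC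
    rw [card_union_of_disjoint hAB] at hcard
    rw [pairSum_node hd hA hB, card_union_of_disjoint hAB] at heq
    push_cast at heq
    have hzero : (#A * #B : ℤ) = 0 := by
      by_contra hne
      have hpos : (0 : ℤ) < #A * #B := lt_of_le_of_ne (by positivity) (Ne.symm hne)
      have hm : (#A * #B : ℤ) * (#A + #B) < #A * #B * (node l r).size :=
        mul_lt_mul_of_pos_left (by exact_mod_cast hcard) hpos
      linarith [le_pairSum hl hA, le_pairSum hr hB]
    rw [support_node, mem_union] at hk
    rcases mul_eq_zero.1 hzero with h0 | h0 <;>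
      rw [Nat.cast_eq_zero, card_eq_zero] at h0 <;> subst h0
    · simp only [empty_union] at hi hj hkC heq
      rw [lcaSize_node_right hd (hB hi) (hB hj)]
      rcases hk with hk | hk
      · rw [lcaSize_node_cross' hd (hB hi) hk]
        have := r.lcaSize_le_size i j
        have := l.size_pos
        lia
      · rw [lcaSize_node_right hd (hB hi) hk]
        exact ihr hr hB (by simpa [pairSum] using heq) hi hj hk hkC
    · simp only [union_empty] at hi hj hkC heq
      rw [lcaSize_node_left (hA hi) (hA hj)]
      rcases hk with hk | hk
      · rw [lcaSize_node_left (hA hi) hk]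
        exact ihl hl hA (by simpa [pairSum] using heq) hi hj hk hkC
      · rw [lcaSize_node_cross hd (hA hi) hk]
        have := l.lcaSize_le_size i j
        have := r.size_pos
        lia

/-- The sum over the internal nodes of `t` of the pair sums of the two children, each weighted
by the size of the other child. -/
def siblingCost (g : Fin n → Fin n → ℤ) : HTree n → ℤ
  | .leaf _ => 0
  | .node l r => l.siblingCost g + r.siblingCost g +
      (r.size * pairSum g l.support + l.size * pairSum g r.support)

lemma siblingCost_congr {g g' : Fin n → Fin n → ℤ} {t : HTree n}
    (h : ∀ i ∈ t.support, ∀ j ∈ t.support, g i j = g' i j) :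
    t.siblingCost g = t.siblingCost g' := by
  induction t with
  | leaf a => rfl
  | node l r ihl ihr =>
    simp only [support_node, mem_union] at h
    have h1 : ∀ i ∈ l.support, ∀ j ∈ l.support, g i j = g' i j :=
      fun i hi j hj => h i (.inl hi) j (.inl hj)
    have h2 : ∀ i ∈ r.support, ∀ j ∈ r.support, g i j = g' i j :=
      fun i hi j hj => h i (.inr hi) j (.inr hj)
    simp only [siblingCost, ihl h1, ihr h2, pairSum_congr h1, pairSum_congr h2]

lemma siblingCost_node_self {l r : HTree n} (h : (node l r).leaves.Nodup) :
    3 * (node l r).siblingCost (node l r).lcaSizeInt =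
      3 * l.siblingCost l.lcaSizeInt + 3 * r.siblingCost r.lcaSizeInt +
      (r.size * (2 * (l.size : ℤ) ^ 3 + l.size) + l.size * (2 * (r.size : ℤ) ^ 3 + r.size)) := by
  obtain ⟨hl, hr, hd⟩ := nodup_node.1 h
  have h1 : ∀ i ∈ l.support, ∀ j ∈ l.support,
      (node l r).lcaSizeInt i j = l.lcaSizeInt i j := fun i hi j hj => by
    rw [lcaSizeInt, lcaSize_node_left hi hj, lcaSizeInt]
  have h2 : ∀ i ∈ r.support, ∀ j ∈ r.support,
      (node l r).lcaSizeInt i j = r.lcaSizeInt i j := fun i hi j hj => by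
    rw [lcaSizeInt, lcaSize_node_right hd hi hj, lcaSizeInt]
  rw [siblingCost, siblingCost_congr h1, siblingCost_congr h2, pairSum_congr h1, pairSum_congr h2,
    ← pairSum_support hl, ← pairSum_support hr]
  ring

lemma siblingCost_self_le {t H : HTree n} (ht : t.leaves.Nodup) (hH : H.leaves.Nodup)
    (hsub : t.support ⊆ H.support) :
    t.siblingCost t.lcaSizeInt ≤ t.siblingCost H.lcaSizeInt := by
  induction t with
  | leaf a => exact le_rfl
  | node l r ihl ihr =>
    obtain ⟨hl, hr, hd⟩ := nodup_node.1 ht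
    obtain ⟨hsl, hsr⟩ := union_subset_iff.1 (support_node l r ▸ hsub)
    have h1 := mul_le_mul_of_nonneg_left (le_pairSum hH hsl) (Int.natCast_nonneg r.size)
    have h2 := mul_le_mul_of_nonneg_left (le_pairSum hH hsr) (Int.natCast_nonneg l.size)
    rw [card_support hl] at h1
    rw [card_support hr] at h2
    have h3 := siblingCost_node_self ht
    simp only [siblingCost] at h3 ⊢
    linarith [ihl hl hsl, ihr hr hsr]

lemma lcaSize_lt_of_siblingCost_le {t H : HTree n} (ht : t.leaves.Nodup) (hH : H.leaves.Nodup)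
    (hsub : t.support ⊆ H.support)
    (hle : t.siblingCost H.lcaSizeInt ≤ t.siblingCost t.lcaSizeInt)
    {i j k : Fin n} (hi : i ∈ t.support) (hj : j ∈ t.support) (hk : k ∈ t.support)
    (hs : t.Separates i j k) : H.lcaSize i j < H.lcaSize i k := by
  induction t with
  | leaf a =>
    rw [support_leaf, mem_singleton] at hi hj
    exact absurd (hi.trans hj.symm) hs.1
  | node l r ihl ihr =>
    obtain ⟨hl, hr, hd⟩ := nodup_node.1 ht
    obtain ⟨hsl, hsr⟩ := union_subset_iff.1 (support_node l r ▸ hsub)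
    have hbl := le_pairSum hH hsl
    have hbr := le_pairSum hH hsr
    have h1 := mul_le_mul_of_nonneg_left hbl (Int.natCast_nonneg r.size)
    have h2 := mul_le_mul_of_nonneg_left hbr (Int.natCast_nonneg l.size)
    have h3 := siblingCost_node_self ht
    have h4 := siblingCost_self_le hl hH hsl
    have h5 := siblingCost_self_le hr hH hsr
    have hlpos : (0 : ℤ) < l.size := by exact_mod_cast l.size_pos
    have hrpos : (0 : ℤ) < r.size := by exact_mod_cast r.size_pos
    rw [← card_support hl, ← card_support hr] at h3
    rw [← card_support hl] at h2 hlpos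
    rw [← card_support hr] at h1 hrpos
    have hsplit : (node l r).siblingCost H.lcaSizeInt =
        l.siblingCost H.lcaSizeInt + r.siblingCost H.lcaSizeInt +
        (#r.support * pairSum H.lcaSizeInt l.support +
          #l.support * pairSum H.lcaSizeInt r.support) := by
      rw [siblingCost, card_support hl, card_support hr]
    have hle1 : l.siblingCost H.lcaSizeInt ≤ l.siblingCost l.lcaSizeInt := by linarith
    have hle2 : r.siblingCost H.lcaSizeInt ≤ r.siblingCost r.lcaSizeInt := by linarith
    have heql := le_antisymm (le_of_mul_le_mul_left (by linarith) hrpos) hbl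
    have heqr := le_antisymm (le_of_mul_le_mul_left (by linarith) hlpos) hbr
    rw [support_node, mem_union] at hi hj hk
    rcases hi with hi | hi <;> rcases hj with hj | hj
    · rcases hk with hk | hk
      · exact ihl hl hsl hle1 hi hj hk ((separates_node_left hi hj hk).1 hs)
      · exact lcaSize_lt_of_pairSum_eq hH hsl heql hi hj (hsr hk) (disjoint_right.1 hd hk)
    · exact absurd hs (not_separates_node_cross hd hi hj)
    · exact absurd hs (not_separates_node_cross' hd hi hj)
    · rcases hk with hk | hk
      · exact lcaSize_lt_of_pairSum_eq hH hsr heqr hi hj (hsl hk) (disjoint_left.1 hd hk)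
      · exact ihr hr hsr hle2 hi hj hk ((separates_node_right hd hi hj hk).1 hs)

/-- The revenue, with `g` in place of `|H(· ∨ ·)|`, of the triplets induced by `t` on its
leaves. -/
def tripletSum (g : Fin n → Fin n → ℤ) (t : HTree n) : ℤ :=
  ∑ i ∈ t.support, ∑ j ∈ t.support, ∑ k ∈ t.support,
    if t.Separates i j k then g i k - g i j else 0

lemma tripletSum_node {g : Fin n → Fin n → ℤ} {l r : HTree n}
    (hd : Disjoint l.support r.support) :
    (node l r).tripletSum g = l.tripletSum g + r.tripletSum g +
      (∑ i ∈ l.support, ∑ j ∈ l.support, ∑ k ∈ r.support, (if i ≠ j then g i k - g i j else 0)) +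
      ∑ i ∈ r.support, ∑ j ∈ r.support, ∑ k ∈ l.support, (if i ≠ j then g i k - g i j else 0) := by
  have hl : ∀ i ∈ l.support, ∑ j ∈ (node l r).support, ∑ k ∈ (node l r).support,
      (if (node l r).Separates i j k then g i k - g i j else 0) =
      (∑ j ∈ l.support, ∑ k ∈ l.support, if l.Separates i j k then g i k - g i j else 0) +
      ∑ j ∈ l.support, ∑ k ∈ r.support, if i ≠ j then g i k - g i j else 0 := by
    intro i hi
    rw [support_node, sum_union hd, ← sum_add_distrib]
    rw [sum_eq_zero fun j hj => sum_eq_zero fun k _ =>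
      if_neg (not_separates_node_cross hd hi hj), add_zero]
    refine sum_congr rfl fun j hj => ?_
    rw [sum_union hd]
    congr 1
    · exact sum_congr rfl fun k hk => if_congr (separates_node_left hi hj hk) rfl rfl
    · exact sum_congr rfl fun k hk => if_congr (separates_node_left_right hd hi hj hk) rfl rfl
  have hr : ∀ i ∈ r.support, ∑ j ∈ (node l r).support, ∑ k ∈ (node l r).support,
      (if (node l r).Separates i j k then g i k - g i j else 0) =
      (∑ j ∈ r.support, ∑ k ∈ r.support, if r.Separates i j k then g i k - g i j else 0) +
      ∑ j ∈ r.support, ∑ k ∈ l.support, if i ≠ j then g i k - g i j else 0 := by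
    intro i hi
    rw [support_node, sum_union hd, ← sum_add_distrib]
    rw [sum_eq_zero fun j hj => sum_eq_zero fun k _ =>
      if_neg (not_separates_node_cross' hd hi hj), zero_add]
    refine sum_congr rfl fun j hj => ?_
    rw [sum_union hd, add_comm]
    congr 1
    · exact sum_congr rfl fun k hk => if_congr (separates_node_right hd hi hj hk) rfl rfl
    · exact sum_congr rfl fun k hk => if_congr (separates_node_right_left hd hi hj hk) rfl rfl
  have hsplit : (node l r).tripletSum g =
      (∑ i ∈ l.support, ∑ j ∈ (node l r).support, ∑ k ∈ (node l r).support,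
        if (node l r).Separates i j k then g i k - g i j else 0) +
      ∑ i ∈ r.support, ∑ j ∈ (node l r).support, ∑ k ∈ (node l r).support,
        if (node l r).Separates i j k then g i k - g i j else 0 := by
    rw [← sum_union hd, ← support_node, tripletSum]
  rw [hsplit, sum_congr rfl hl, sum_congr rfl hr, sum_add_distrib, sum_add_distrib, tripletSum,
    tripletSum]
  ring

/-- Up to a constant that depends only on `t`, the revenue is a combination of the pair sum over
all leaves and the sibling cost. -/
lemma exists_tripletSum_eq {t : HTree n} (ht : t.leaves.Nodup) :
    ∃ K : ℤ, ∀ g : Fin n → Fin n → ℤ, (∀ i j, g i j = g j i) → (∀ i ∈ t.support, g i i = 1) →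
      2 * t.tripletSum g = ((t.size : ℤ) - 2) * pairSum g t.support - 3 * t.siblingCost g + K := by
  induction t with
  | leaf a =>
    refine ⟨1, fun g _ hg1 => ?_⟩
    have hga : g a a = 1 := hg1 a (mem_singleton_self a)
    simp [tripletSum, siblingCost, pairSum, support_leaf, Separates, size, leaves, hga]
  | node l r ihl ihr =>
    obtain ⟨hl, hr, hd⟩ := nodup_node.1 ht
    obtain ⟨K, hK⟩ := ihl hl
    obtain ⟨K', hK'⟩ := ihr hr
    refine ⟨K + K' + 4 * (l.size * r.size), fun g hg hg1 => ?_⟩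
    simp only [support_node, mem_union] at hg1
    have h1 : ∀ i ∈ l.support, g i i = 1 := fun i hi => hg1 i (.inl hi)
    have h2 : ∀ i ∈ r.support, g i i = 1 := fun i hi => hg1 i (.inr hi)
    have hrl : ∑ i ∈ r.support, ∑ k ∈ l.support, g i k =
        ∑ i ∈ l.support, ∑ k ∈ r.support, g i k := by
      rw [sum_comm]
      exact sum_congr rfl fun i _ => sum_congr rfl fun j _ => hg _ _
    rw [tripletSum_node hd, sum_off_diag_sub _ _ h1, sum_off_diag_sub _ _ h2, hrl, support_node,
      pairSum_union hg hd, size_node, siblingCost, card_support hl, card_support hr]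
    push_cast
    linear_combination hK g hg h1 + hK' g hg h2

end HTree

lemma IsHierarchy.support_eq {n : ℕ} {H : HTree n} (hH : IsHierarchy H) : H.support = univ :=
  eq_univ_iff_forall.2 fun i => HTree.mem_support.2 (hH.2 i)

lemma mem_inducedTriplets {n : ℕ} {H : HTree n} {i j k : Fin n} :
    (i, j, k) ∈ inducedTriplets H ↔ H.Separates i j k := by
  simp [inducedTriplets]

lemma trev_inducedTriplets {n : ℕ} {H0 : HTree n} (hH0 : IsHierarchy H0) (H : HTree n) :
    Trev H (inducedTriplets H0) = H0.tripletSum H.lcaSizeInt := by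
  simp only [Trev, inducedTriplets, sum_filter, Fintype.sum_prod_type, HTree.tripletSum,
    hH0.support_eq, HTree.lcaSizeInt]

/-- The loss of revenue of `H` against `H0` is proportional to the excess of sibling cost. -/
lemma two_mul_trev_sub {n : ℕ} {H0 H : HTree n} (hH0 : IsHierarchy H0) (hH : IsHierarchy H) :
    2 * (Trev H0 (inducedTriplets H0) - Trev H (inducedTriplets H0)) =
      3 * (H0.siblingCost H.lcaSizeInt - H0.siblingCost H0.lcaSizeInt) := by
  obtain ⟨K, hK⟩ := HTree.exists_tripletSum_eq hH0.1
  have h0 := hK _ H0.lcaSizeInt_comm fun i hi => HTree.lcaSizeInt_self hi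
  have h1 := hK _ H.lcaSizeInt_comm fun i _ => HTree.lcaSizeInt_self (HTree.mem_support.2 (hH.2 i))
  have hsize : H.size = H0.size := by
    rw [← HTree.card_support hH.1, ← HTree.card_support hH0.1, hH.support_eq, hH0.support_eq]
  have hp0 := HTree.pairSum_support hH0.1
  have hp1 := HTree.pairSum_support hH.1
  rw [hH.support_eq, hsize] at hp1
  rw [hH0.support_eq] at hp0 h0 h1
  have hp : pairSum H.lcaSizeInt univ = pairSum H0.lcaSizeInt univ := by linarith
  rw [trev_inducedTriplets hH0, trev_inducedTriplets hH0]
  rw [hp] at h1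
  linarith

lemma inducedTriplets_eq_of_subset {n : ℕ} {H0 H : HTree n} (hH0 : IsHierarchy H0)
    (h : inducedTriplets H0 ⊆ inducedTriplets H) : inducedTriplets H = inducedTriplets H0 := by
  refine Subset.antisymm ?_ h
  rintro ⟨i, j, k⟩ hs
  have hsub : ∀ {a b c}, H0.Separates a b c → H.Separates a b c := fun hs =>
    mem_inducedTriplets.1 (h (mem_inducedTriplets.2 hs))
  rw [mem_inducedTriplets] at hs ⊢
  have hmem : ∀ a, a ∈ H0.support := fun a => HTree.mem_support.2 (hH0.2 a)
  rcases HTree.separates_trichotomy hH0.1 (hmem i) (hmem j) (hmem k) hs.1 hs.2.1 hs.2.2.1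
    with h' | h' | h'
  · exact h'
  · have h1 := hs.2.2.2
    have h2 := (hsub h').2.2.2
    lia
  · have h1 := hs.2.2.2
    have h2 := (hsub h').2.2.2
    rw [H.lcaSize_comm j i] at h2
    lia

/-- `H0` maximizes `H ↦ Trev(H, T0)` over all hierarchies on `[n]`, and strictly so
for every hierarchy whose induced triplet set differs from `T0`. -/
theorem H0_maximizes_trev {n : ℕ} (H0 : HTree n) (hH0 : IsHierarchy H0) :
    (∀ H : HTree n, IsHierarchy H →
      Trev H (inducedTriplets H0) ≤ Trev H0 (inducedTriplets H0)) ∧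
    (∀ H1 : HTree n, IsHierarchy H1 → inducedTriplets H1 ≠ inducedTriplets H0 →
      Trev H1 (inducedTriplets H0) < Trev H0 (inducedTriplets H0)) := by
  have hsub : ∀ H : HTree n, IsHierarchy H → H0.support ⊆ H.support := fun H hH => by
    rw [hH.support_eq]
    exact subset_univ _
  refine ⟨fun H hH => ?_, fun H hH hne => ?_⟩
  · linarith [two_mul_trev_sub hH0 hH, HTree.siblingCost_self_le hH0.1 hH.1 (hsub H hH)]
  · by_contra hlt
    refine hne (inducedTriplets_eq_of_subset hH0 ?_)
    have hle : H0.siblingCost H.lcaSizeInt ≤ H0.siblingCost H0.lcaSizeInt := by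
      linarith [two_mul_trev_sub hH0 hH]
    have hmem : ∀ a, a ∈ H0.support := fun a => HTree.mem_support.2 (hH0.2 a)
    have key : ∀ {a b c}, H0.Separates a b c → H.lcaSize a b < H.lcaSize a c := fun hs =>
      HTree.lcaSize_lt_of_siblingCost_le hH0.1 hH.1 (hsub H hH) hle (hmem _) (hmem _) (hmem _) hs
    rintro ⟨i, j, k⟩ hs
    rw [mem_inducedTriplets] at hs ⊢
    exact ⟨hs.1, hs.2.1, hs.2.2.1, lt_min (key hs) (H.lcaSize_comm i j ▸ key hs.swap)⟩

end CompHC
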